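/- (Lemma S2.1, item 2) Suppose the random vectors P_1 and P_2 are independent, P_2 is PRDS on {j : h_{2j} = 0}, and S is a valid selection rule. Then the rejection set 𝓡 of Procedure 3.2 with parameters (q_1, q) satisfies E[|𝓡 ∩ I_{10}| / max(|𝓡|, 1)] ≤ q − q_1. -/

import Mathlib

open MeasureTheory ProbabilityTheory Finset

namespace Replicability

/-- A selection rule `S` is measurable: the preimage of each possible selected set is a
measurable subset of `[0,1]^m` (here all of `ℝ^m`). -/
def MeasRule (m : ℕ) (S : (Fin m → ℝ) → Finset (Fin m)) : Prop :=
  ∀ A : Finset (Fin m), MeasurableSet {p : Fin m → ℝ | S p = A}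

/-- A valid selection rule: for any `p`, any `j ∈ S p`, and any `p'` agreeing with `p` in all
coordinates except possibly the `j`-th such that `j` is still selected under `p'`,
the selected set is unchanged. -/
def ValidRule (m : ℕ) (S : (Fin m → ℝ) → Finset (Fin m)) : Prop :=
  ∀ p p' : Fin m → ℝ, ∀ j ∈ S p, (∀ i, i ≠ j → p' i = p i) → j ∈ S p' → S p' = S p

/-- Null p-values are superuniform: if `h j = false` (hypothesis `j` is a true null in this
study) then `Pr(P_j ≤ x) ≤ x` for all `x ∈ [0,1]`. -/
def Superuniform {Ω : Type*} [MeasurableSpace Ω] (μ : Measure Ω) {m : ℕ}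
    (P : Ω → Fin m → ℝ) (h : Fin m → Bool) : Prop :=
  ∀ j : Fin m, h j = false → ∀ x : ℝ, 0 ≤ x → x ≤ 1 →
    μ {ω | P ω j ≤ x} ≤ ENNReal.ofReal x

/-- p-values take values in `[0,1]`. -/
def InUnit {Ω : Type*} {m : ℕ} (P : Ω → Fin m → ℝ) : Prop :=
  ∀ ω j, P ω j ∈ Set.Icc (0 : ℝ) 1

/-- The (generalized) rejection set of Procedure 3.2: with selected set `𝓡₁ = S p₁` of size
`R₁`, primary thresholds `r * a / m` and follow-up thresholds `r * b R₁ / R₁`, let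
`R₂ = max { r ≤ m : #{j ∈ 𝓡₁ : p₁ⱼ ≤ r a/m ∧ p₂ⱼ ≤ r (b R₁)/R₁} = r }`, and reject
`{j ∈ 𝓡₁ : p₁ⱼ ≤ R₂ a/m ∧ p₂ⱼ ≤ R₂ (b R₁)/R₁}`.  The basic Procedure 3.2 with parameters
`(q₁, q)` is obtained with `a = q₁` and `b = fun _ => q - q₁`. -/
noncomputable def rejSet (m : ℕ) (S : (Fin m → ℝ) → Finset (Fin m))
    (a : ℝ) (b : ℕ → ℝ) (p1 p2 : Fin m → ℝ) : Finset (Fin m) :=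
  let R1 := (S p1).card
  let R2 := sSup {r : ℕ | r ≤ m ∧
    ((S p1).filter
      (fun j => p1 j ≤ r * a / m ∧ p2 j ≤ r * b R1 / R1)).card = r}
  (S p1).filter (fun j => p1 j ≤ R2 * a / m ∧ p2 j ≤ R2 * b R1 / R1)

/-- False discovery proportion of rejection set `R` with respect to the set `I` of true
nulls: `|R ∩ I| / max(|R|, 1)`. -/
noncomputable def FDP {m : ℕ} (I R : Finset (Fin m)) : ℝ :=
  ((R ∩ I).card : ℝ) / ((max R.card 1 : ℕ) : ℝ)

/-- The set `I_{ab} = {j : (h₁ⱼ, h₂ⱼ) = (a, b)}` (with `true` for 1, `false` for 0). -/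
def Iset {m : ℕ} (h1 h2 : Fin m → Bool) (a b : Bool) : Finset (Fin m) :=
  Finset.univ.filter fun j => h1 j = a ∧ h2 j = b

/-- The indices of true no-replicability nulls: `I₀₀ ∪ I₀₁ ∪ I₁₀`. -/
def nullNR {m : ℕ} (h1 h2 : Fin m → Bool) : Finset (Fin m) :=
  Finset.univ.filter fun j => h1 j = false ∨ h2 j = false

/-- Harmonic sum `∑_{i=1}^n 1/i`. -/
noncomputable def Hsum (n : ℕ) : ℝ := ∑ i ∈ Finset.range n, (1 : ℝ) / (i + 1)

/-- PRDS property of a random vector `Q` on a set `T` of coordinates: for every measurable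
increasing set `D` and every `i ∈ T`, some monotone measurable `g` is a version of
`p ↦ Pr(Q ∈ D | Q_i = p)`. -/
def PRDS {Ω : Type*} [MeasurableSpace Ω] (μ : Measure Ω) {m : ℕ}
    (Q : Ω → Fin m → ℝ) (T : Set (Fin m)) : Prop :=
  ∀ D : Set (Fin m → ℝ), MeasurableSet D →
    (∀ x ∈ D, ∀ y : Fin m → ℝ, x ≤ y → y ∈ D) →
    ∀ i ∈ T, ∃ g : ℝ → ℝ, Monotone g ∧ Measurable g ∧
      ∀ B : Set ℝ, MeasurableSet B →
        (μ ({ω | Q ω ∈ D} ∩ {ω | Q ω i ∈ B})).toReal =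
          ∫ ω in {ω | Q ω i ∈ B}, g (Q ω i) ∂μ

end Replicability

namespace Replicability

section StepUp

/-- The largest `r ≤ N` with `r ≤ f r` is a fixed point of a monotone `f` bounded by `N`. -/
lemma apply_findGreatest_le_eq {f : ℕ → ℕ} (hf : Monotone f) {N : ℕ} (hN : ∀ r, f r ≤ N) :
    f (Nat.findGreatest (fun r => r ≤ f r) N) = Nat.findGreatest (fun r => r ≤ f r) N := by
  have h : Nat.findGreatest (fun r => r ≤ f r) N ≤ f (Nat.findGreatest (fun r => r ≤ f r) N) :=
    Nat.findGreatest_spec (P := fun r => r ≤ f r) (Nat.zero_le N) (Nat.zero_le _)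
  exact le_antisymm (Nat.le_findGreatest (hN _) (hf h)) h

lemma sSup_fixedPoints_eq_findGreatest {f : ℕ → ℕ} (hf : Monotone f) {N : ℕ}
    (hN : ∀ r, f r ≤ N) :
    sSup {r : ℕ | r ≤ N ∧ f r = r} = Nat.findGreatest (fun r => r ≤ f r) N :=
  IsGreatest.csSup_eq ⟨⟨Nat.findGreatest_le N, apply_findGreatest_le_eq hf hN⟩,
    fun _ hr => Nat.le_findGreatest hr.1 hr.2.ge⟩

variable {m : ℕ}

/-- The hypotheses in `A` whose p-values are below the `r`-th step-up thresholds. -/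
noncomputable def stepSet (A : Finset (Fin m)) (a c : ℝ) (p1 p2 : Fin m → ℝ) (r : ℕ) :
    Finset (Fin m) :=
  A.filter fun j => p1 j ≤ r * a / m ∧ p2 j ≤ r * c / A.card

/-- The number of rejections of the step-up procedure. -/
noncomputable def numRej (A : Finset (Fin m)) (a c : ℝ) (p1 p2 : Fin m → ℝ) : ℕ :=
  Nat.findGreatest (fun r => r ≤ (stepSet A a c p1 p2 r).card) m

lemma stepSet_mono {A : Finset (Fin m)} {a c : ℝ} (ha : 0 ≤ a) (hc : 0 ≤ c)
    (p1 p2 : Fin m → ℝ) : Monotone (stepSet A a c p1 p2) := by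
  intro r s hrs
  refine Finset.monotone_filter_right A fun j _ hj => ⟨hj.1.trans ?_, hj.2.trans ?_⟩ <;> gcongr

lemma card_stepSet_le (A : Finset (Fin m)) (a c : ℝ) (p1 p2 : Fin m → ℝ) (r : ℕ) :
    (stepSet A a c p1 p2 r).card ≤ m := by
  simpa using Finset.card_le_univ (stepSet A a c p1 p2 r)

lemma card_stepSet_numRej {A : Finset (Fin m)} {a c : ℝ} (ha : 0 ≤ a) (hc : 0 ≤ c)
    (p1 p2 : Fin m → ℝ) :
    (stepSet A a c p1 p2 (numRej A a c p1 p2)).card = numRej A a c p1 p2 :=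
  apply_findGreatest_le_eq (f := fun r => (stepSet A a c p1 p2 r).card)
    (fun _ _ h => Finset.card_le_card (stepSet_mono ha hc p1 p2 h))
    (card_stepSet_le A a c p1 p2)

lemma rejSet_eq_stepSet {S : (Fin m → ℝ) → Finset (Fin m)} {a c : ℝ} (ha : 0 ≤ a) (hc : 0 ≤ c)
    (p1 p2 : Fin m → ℝ) :
    rejSet m S a (fun _ => c) p1 p2 = stepSet (S p1) a c p1 p2 (numRej (S p1) a c p1 p2) := by
  have h := sSup_fixedPoints_eq_findGreatest (f := fun r => (stepSet (S p1) a c p1 p2 r).card)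
    (fun _ _ h => Finset.card_le_card (stepSet_mono ha hc p1 p2 h))
    (card_stepSet_le (S p1) a c p1 p2)
  unfold numRej
  rw [← h]
  rfl

lemma numRej_antitone (A : Finset (Fin m)) (a c : ℝ) (p1 : Fin m → ℝ) :
    Antitone (numRej A a c p1) := by
  intro p p' hp
  refine Nat.findGreatest_mono (fun r hr => hr.trans (Finset.card_le_card ?_)) le_rfl
  exact Finset.monotone_filter_right A fun j _ hj => ⟨hj.1, (hp j).trans hj.2⟩

end StepUp

section Measurability

variable {m : ℕ}

lemma MeasRule.measurableSet_mem {S : (Fin m → ℝ) → Finset (Fin m)} (hS : MeasRule m S)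
    (T : Set (Finset (Fin m))) : MeasurableSet {p | S p ∈ T} := by
  have : {p | S p ∈ T} = ⋃ A ∈ T, {p | S p = A} := by ext p; simp
  rw [this]
  exact .biUnion T.to_countable fun A _ => hS A

lemma MeasRule.measurable_card {S : (Fin m → ℝ) → Finset (Fin m)} (hS : MeasRule m S) :
    Measurable fun p => (S p).card :=
  measurable_to_countable' fun k => hS.measurableSet_mem {A | A.card = k}

lemma measurableSet_mem_stepSet {S : (Fin m → ℝ) → Finset (Fin m)} (hS : MeasRule m S)
    (a c : ℝ) (r : ℕ) (j : Fin m) :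
    MeasurableSet {x : (Fin m → ℝ) × (Fin m → ℝ) | j ∈ stepSet (S x.1) a c x.1 x.2 r} := by
  have hcard : Measurable fun x : (Fin m → ℝ) × (Fin m → ℝ) => ((S x.1).card : ℝ) :=
    measurable_from_top.comp (hS.measurable_card.comp measurable_fst)
  simp only [stepSet, Finset.mem_filter]
  refine (measurable_fst (hS.measurableSet_mem {A | j ∈ A})).inter (.inter ?_ ?_)
  · exact measurableSet_le (f := fun x : (Fin m → ℝ) × (Fin m → ℝ) => x.1 j)
      (by fun_prop) measurable_const
  · exact measurableSet_le (f := fun x : (Fin m → ℝ) × (Fin m → ℝ) => x.2 j)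
      (by fun_prop) (measurable_const.div hcard)

lemma measurable_card_of_measurableSet_mem {X : Type*} [MeasurableSpace X]
    {F : X → Finset (Fin m)} (hF : ∀ j, MeasurableSet {x | j ∈ F x}) (I : Finset (Fin m)) :
    Measurable fun x => (F x ∩ I).card := by
  have : (fun x => (F x ∩ I).card) =
      fun x => ∑ j ∈ I, {x | j ∈ F x}.indicator (fun _ => 1) x := by
    ext x
    simp [Set.indicator_apply, Finset.inter_comm]
  rw [this]
  exact Finset.measurable_sum _ fun j _ => measurable_const.indicator (hF j)

lemma measurable_numRej {S : (Fin m → ℝ) → Finset (Fin m)} (hS : MeasRule m S) (a c : ℝ) :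
    Measurable fun x : (Fin m → ℝ) × (Fin m → ℝ) => numRej (S x.1) a c x.1 x.2 := by
  refine measurable_findGreatest fun r _ => measurableSet_le measurable_const ?_
  simpa using measurable_card_of_measurableSet_mem (measurableSet_mem_stepSet hS a c r) univ

lemma measurable_FDP_rejSet {S : (Fin m → ℝ) → Finset (Fin m)} (hS : MeasRule m S) {a c : ℝ}
    (ha : 0 ≤ a) (hc : 0 ≤ c) (I : Finset (Fin m)) :
    Measurable fun x : (Fin m → ℝ) × (Fin m → ℝ) => FDP I (rejSet m S a (fun _ => c) x.1 x.2) := by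
  have hmem : ∀ j, MeasurableSet
      {x : (Fin m → ℝ) × (Fin m → ℝ) | j ∈ rejSet m S a (fun _ => c) x.1 x.2} := by
    intro j
    have : {x : (Fin m → ℝ) × (Fin m → ℝ) | j ∈ rejSet m S a (fun _ => c) x.1 x.2} =
        ⋃ r : ℕ, {x | numRej (S x.1) a c x.1 x.2 = r} ∩
          {x | j ∈ stepSet (S x.1) a c x.1 x.2 r} := by
      ext x
      simp [rejSet_eq_stepSet ha hc]
    rw [this]
    exact .iUnion fun r => (measurable_numRej hS a c (measurableSet_singleton r)).inter
      (measurableSet_mem_stepSet hS a c r j)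
  have hnum := measurable_card_of_measurableSet_mem hmem I
  have hden := measurable_card_of_measurableSet_mem hmem univ
  simp only [Finset.inter_univ] at hden
  unfold FDP
  exact (measurable_from_top.comp hnum).div
    (measurable_from_top.comp (hden.max measurable_const))

end Measurability

lemma FDP_nonneg {m : ℕ} (I R : Finset (Fin m)) : 0 ≤ FDP I R := by
  unfold FDP; positivity

lemma FDP_le_one {m : ℕ} (I R : Finset (Fin m)) : FDP I R ≤ 1 := by
  unfold FDP
  refine div_le_one_of_le₀ ?_ (by positivity)
  exact_mod_cast (Finset.card_le_card Finset.inter_subset_left).trans (le_max_left _ _)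

/-- Each rejection contributes the reciprocal of the number of rejections to the FDP. -/
lemma FDP_rejSet_le {m : ℕ} {S : (Fin m → ℝ) → Finset (Fin m)} {a c : ℝ}
    (ha : 0 ≤ a) (hc : 0 ≤ c) (I : Finset (Fin m)) (p1 p2 : Fin m → ℝ) :
    FDP I (rejSet m S a (fun _ => c) p1 p2) ≤
      ∑ j ∈ S p1 ∩ I, ∑ r ∈ range (S p1).card,
        {p : Fin m → ℝ | p j ≤ c / (S p1).card * (r + 1 : ℕ) ∧
          numRej (S p1) a c p1 p = r + 1}.indicator (fun _ => 1 / ((r + 1 : ℕ) : ℝ)) p2 := by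
  have hcard := card_stepSet_numRej (A := S p1) ha hc p1 p2
  rw [rejSet_eq_stepSet ha hc]
  set N := numRej (S p1) a c p1 p2 with hN
  set R := stepSet (S p1) a c p1 p2 N with hR
  have hRS : R ⊆ S p1 := Finset.filter_subset _ _
  have hterm : ∀ j ∈ R ∩ I, 1 / ((max R.card 1 : ℕ) : ℝ) ≤ ∑ r ∈ range (S p1).card,
        {p : Fin m → ℝ | p j ≤ c / (S p1).card * (r + 1 : ℕ) ∧
          numRej (S p1) a c p1 p = r + 1}.indicator (fun _ => 1 / ((r + 1 : ℕ) : ℝ)) p2 := by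
    intro j hj
    have hjR := (Finset.mem_inter.1 hj).1
    have hpos : 0 < N := hcard ▸ Finset.card_pos.2 ⟨j, hjR⟩
    have hle : N ≤ (S p1).card := hcard ▸ Finset.card_le_card hRS
    obtain ⟨k, hk⟩ : ∃ k, N = k + 1 := ⟨N - 1, by omega⟩
    have hpj : p2 j ≤ c / (S p1).card * (k + 1 : ℕ) := by
      have := (Finset.mem_filter.1 hjR).2.2
      rw [hk] at this
      convert this using 1
      ring
    refine le_trans ?_ (Finset.single_le_sum (fun r _ => Set.indicator_nonneg
      (fun _ _ => by positivity) _) (Finset.mem_range.2 (show k < (S p1).card by omega)))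
    rw [Set.indicator_of_mem (Set.mem_ofPred.2 ⟨hpj, hN ▸ hk⟩), hcard, hk]
    simp
  calc FDP I R = ∑ j ∈ R ∩ I, 1 / ((max R.card 1 : ℕ) : ℝ) := by
        simp [FDP, div_eq_mul_inv]
    _ ≤ _ := Finset.sum_le_sum hterm
    _ ≤ _ := Finset.sum_le_sum_of_subset_of_nonneg
        (Finset.inter_subset_inter_right hRS) fun j _ _ => Finset.sum_nonneg fun r _ =>
          Set.indicator_nonneg (fun _ _ => by positivity) _

section PRDS

variable {Ω : Type*} [MeasurableSpace Ω] {μ : Measure Ω} [IsProbabilityMeasure μ] {m : ℕ}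
  {Q : Ω → Fin m → ℝ} {T : Set (Fin m)}

/-- Under PRDS, `u ↦ Pr(Q ∈ D | Q_i ≤ u)` is nondecreasing for increasing `D`. -/
lemma PRDS.monotone_cond_le (hQ : Measurable Q) (hQu : InUnit Q) (h : PRDS μ Q T)
    {D : Set (Fin m → ℝ)} (hD : MeasurableSet D) (hDu : IsUpperSet D) {i : Fin m} (hi : i ∈ T) :
    Monotone fun u : ℝ => μ.real ({ω | Q ω ∈ D} ∩ {ω | Q ω i ≤ u}) / μ.real {ω | Q ω i ≤ u} := by
  obtain ⟨g, hg, hgm, hgi⟩ := h D hD (fun x hx y hxy => hDu hxy hx) i hi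
  intro u v huv
  have hQi : Measurable fun ω => Q ω i := (measurable_pi_apply i).comp hQ
  have hint : Integrable (fun ω => g (Q ω i)) μ :=
    Integrable.of_mem_Icc (g 0) (g 1) (hgm.comp hQi).aemeasurable
      (ae_of_all _ fun ω => ⟨hg (hQu ω i).1, hg (hQu ω i).2⟩)
  have hmu : MeasurableSet {ω | Q ω i ≤ u} := hQi measurableSet_Iic
  have hmuv : MeasurableSet {ω | Q ω i ∈ Set.Ioc u v} := hQi measurableSet_Ioc
  have hdisj : Disjoint {ω | Q ω i ≤ u} {ω | Q ω i ∈ Set.Ioc u v} :=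
    Set.disjoint_left.2 fun ω h1 h2 => not_lt.2 h1 h2.1
  have hunion : {ω | Q ω i ≤ v} = {ω | Q ω i ≤ u} ∪ {ω | Q ω i ∈ Set.Ioc u v} := by
    ext ω
    exact Set.ext_iff.1 (Set.Iic_union_Ioc_eq_Iic huv).symm (Q ω i)
  have hau : μ.real ({ω | Q ω ∈ D} ∩ {ω | Q ω i ≤ u}) = ∫ ω in {ω | Q ω i ≤ u}, g (Q ω i) ∂μ :=
    hgi (Set.Iic u) measurableSet_Iic
  have hav : μ.real ({ω | Q ω ∈ D} ∩ {ω | Q ω i ≤ v}) =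
      ∫ ω in {ω | Q ω i ≤ u}, g (Q ω i) ∂μ + ∫ ω in {ω | Q ω i ∈ Set.Ioc u v}, g (Q ω i) ∂μ := by
    rw [← setIntegral_union hdisj hmuv hint.integrableOn hint.integrableOn, ← hunion]
    exact hgi (Set.Iic v) measurableSet_Iic
  have hpv : μ.real {ω | Q ω i ≤ v} = μ.real {ω | Q ω i ≤ u} + μ.real {ω | Q ω i ∈ Set.Ioc u v} := by
    rw [hunion, measureReal_union hdisj hmuv]
  have hle : ∫ ω in {ω | Q ω i ≤ u}, g (Q ω i) ∂μ ≤ g u * μ.real {ω | Q ω i ≤ u} := by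
    calc _ ≤ ∫ _ in {ω | Q ω i ≤ u}, g u ∂μ :=
          setIntegral_mono_on hint.integrableOn (integrable_const _) hmu fun ω hω => hg hω
      _ = _ := by simp [mul_comm]
  have hge : g u * μ.real {ω | Q ω i ∈ Set.Ioc u v} ≤
      ∫ ω in {ω | Q ω i ∈ Set.Ioc u v}, g (Q ω i) ∂μ := by
    calc _ = ∫ _ in {ω | Q ω i ∈ Set.Ioc u v}, g u ∂μ := by simp [mul_comm]
      _ ≤ _ := setIntegral_mono_on (integrable_const _) hint.integrableOn hmuv
          fun ω hω => hg hω.1.le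
  change _ / _ ≤ _ / _
  rcases (measureReal_nonneg (μ := μ) (s := {ω | Q ω i ≤ u})).eq_or_lt with h0 | h0
  · rw [← h0, div_zero]; positivity
  have h0' : 0 ≤ μ.real {ω | Q ω i ∈ Set.Ioc u v} := measureReal_nonneg
  rw [hav, hau, hpv, div_le_div_iff₀ h0 (by linarith)]
  nlinarith [mul_le_mul_of_nonneg_right hle h0', mul_le_mul_of_nonneg_right hge h0.le]

/-- For a PRDS null p-value `Q_i` and a count `N` nonincreasing in the p-values,
`E[1{Q_i ≤ t N} / N; 1 ≤ N ≤ n] ≤ t`. -/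
lemma PRDS.sum_measureReal_le (hQ : Measurable Q) (hQu : InUnit Q) (h : PRDS μ Q T)
    {i : Fin m} (hi : i ∈ T) (hsup : ∀ x : ℝ, 0 ≤ x → x ≤ 1 → μ {ω | Q ω i ≤ x} ≤ ENNReal.ofReal x)
    {N : (Fin m → ℝ) → ℕ} (hN : Measurable N) (hNa : Antitone N) {t : ℝ} (ht : 0 ≤ t) {n : ℕ}
    (htn : t * n ≤ 1) :
    ∑ r ∈ range n, 1 / ((r + 1 : ℕ) : ℝ) *
      μ.real {ω | Q ω i ≤ t * (r + 1 : ℕ) ∧ N (Q ω) = r + 1} ≤ t := by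
  have hQi : Measurable fun ω => Q ω i := (measurable_pi_apply i).comp hQ
  have hDm (k : ℕ) : MeasurableSet {p | N p ≤ k} := hN measurableSet_Iic
  have hDu (k : ℕ) : IsUpperSet {p | N p ≤ k} := fun p p' hpp hp => (hNa hpp).trans hp
  let f : ℕ → ℝ := fun r => μ.real ({ω | Q ω ∈ {p | N p ≤ r}} ∩ {ω | Q ω i ≤ t * (r + 1 : ℕ)}) /
    μ.real {ω | Q ω i ≤ t * (r + 1 : ℕ)}
  have hf0 : 0 ≤ f 0 := by positivity
  have hf1 : f n ≤ 1 := div_le_one_of_le₀ (measureReal_mono Set.inter_subset_right) (by positivity)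
  have hstep : ∀ r ∈ range n, 1 / ((r + 1 : ℕ) : ℝ) *
      μ.real {ω | Q ω i ≤ t * (r + 1 : ℕ) ∧ N (Q ω) = r + 1} ≤ t * (f (r + 1) - f r) := by
    intro r hr
    have hmono := h.monotone_cond_le hQ hQu (hDm (r + 1)) (hDu (r + 1)) hi
      (show t * (r + 1 : ℕ) ≤ t * (r + 1 + 1 : ℕ) by gcongr; omega)
    have hsplit : μ.real ({ω | Q ω ∈ {p | N p ≤ r + 1}} ∩ {ω | Q ω i ≤ t * (r + 1 : ℕ)}) =
        μ.real ({ω | Q ω ∈ {p | N p ≤ r}} ∩ {ω | Q ω i ≤ t * (r + 1 : ℕ)}) +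
        μ.real {ω | Q ω i ≤ t * (r + 1 : ℕ) ∧ N (Q ω) = r + 1} := by
      rw [← measureReal_union]
      · congr 1
        ext ω
        simp only [Set.mem_inter_iff, Set.mem_union, Set.mem_ofPred_eq, Nat.le_succ_iff]
        tauto
      · refine Set.disjoint_left.2 fun ω h1 h2 => ?_
        have h3 : N (Q ω) ≤ r := h1.1
        have h4 := h2.2
        omega
      · exact (hQi measurableSet_Iic).inter ((hN.comp hQ) (measurableSet_singleton (r + 1)))
    have hp : μ.real {ω | Q ω i ≤ t * (r + 1 : ℕ)} ≤ t * (r + 1 : ℕ) := by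
      have hr' : r + 1 ≤ n := Finset.mem_range.1 hr
      refine ENNReal.toReal_le_of_le_ofReal (by positivity) (hsup _ (by positivity) ?_)
      exact le_trans (by gcongr) htn
    have hsub : μ.real {ω | Q ω i ≤ t * (r + 1 : ℕ) ∧ N (Q ω) = r + 1} ≤
        μ.real {ω | Q ω i ≤ t * (r + 1 : ℕ)} := measureReal_mono fun ω hω => hω.1
    have hdiff : μ.real {ω | Q ω i ≤ t * (r + 1 : ℕ) ∧ N (Q ω) = r + 1} /
        μ.real {ω | Q ω i ≤ t * (r + 1 : ℕ)} ≤ f (r + 1) - f r := by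
      have := hmono
      simp only [hsplit, add_div] at this
      linarith
    refine le_trans ?_ (mul_le_mul_of_nonneg_left hdiff ht)
    rw [one_div_mul_eq_div, div_le_iff₀ (by positivity)]
    rcases (measureReal_nonneg (μ := μ) (s := {ω | Q ω i ≤ t * (r + 1 : ℕ)})).eq_or_lt with h0 | h0
    · rw [← h0] at hsub ⊢
      simpa using hsub
    · rw [mul_right_comm, mul_div_assoc', le_div_iff₀ h0, mul_comm]
      gcongr
  calc _ ≤ ∑ r ∈ range n, t * (f (r + 1) - f r) := Finset.sum_le_sum hstep
    _ = t * (f n - f 0) := by rw [← Finset.mul_sum, Finset.sum_range_sub]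
    _ ≤ t * 1 := by gcongr; linarith
    _ = t := mul_one t

end PRDS

/-- FDR control of the follow-up step with the primary study held fixed. -/
lemma integral_FDP_rejSet_le {Ω : Type*} [MeasurableSpace Ω] {μ : Measure Ω}
    [IsProbabilityMeasure μ] {m : ℕ} {P : Ω → Fin m → ℝ} (hP : Measurable P) (hPu : InUnit P)
    {h : Fin m → Bool} (hsup : Superuniform μ P h) (hPRDS : PRDS μ P {j | h j = false})
    {S : (Fin m → ℝ) → Finset (Fin m)} (hS : MeasRule m S) {a c : ℝ} (ha : 0 ≤ a) (hc : 0 ≤ c)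
    (hc1 : c ≤ 1) {I : Finset (Fin m)} (hI : ∀ j ∈ I, h j = false) (p1 : Fin m → ℝ) :
    ∫ ω, FDP I (rejSet m S a (fun _ => c) p1 (P ω)) ∂μ ≤ c := by
  have hNm : Measurable (numRej (S p1) a c p1) :=
    (measurable_numRej hS a c).comp measurable_prodMk_left
  have hset (j : Fin m) (r : ℕ) : MeasurableSet {p : Fin m → ℝ |
      p j ≤ c / (S p1).card * (r + 1 : ℕ) ∧ numRej (S p1) a c p1 p = r + 1} :=
    ((measurable_pi_apply j) measurableSet_Iic).inter (hNm (measurableSet_singleton (r + 1)))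
  have hind (j : Fin m) (r : ℕ) : Integrable (fun ω => {p : Fin m → ℝ |
      p j ≤ c / (S p1).card * (r + 1 : ℕ) ∧ numRej (S p1) a c p1 p = r + 1}.indicator
        (fun _ => 1 / ((r + 1 : ℕ) : ℝ)) (P ω)) μ :=
    (integrable_const (1 / ((r + 1 : ℕ) : ℝ))).indicator (hP (hset j r))
  have hFDP : Integrable (fun ω => FDP I (rejSet m S a (fun _ => c) p1 (P ω))) μ :=
    Integrable.of_mem_Icc 0 1 ((measurable_FDP_rejSet hS ha hc I).comp
      (measurable_prodMk_left.comp hP)).aemeasurable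
      (ae_of_all _ fun ω => ⟨FDP_nonneg _ _, FDP_le_one _ _⟩)
  have hcard : c / (S p1).card * (S p1).card ≤ c := by
    rcases eq_or_ne ((S p1).card : ℝ) 0 with h0 | h0
    · simpa [h0] using hc
    · exact (div_mul_cancel₀ c h0).le
  calc _ ≤ ∫ ω, ∑ j ∈ S p1 ∩ I, ∑ r ∈ range (S p1).card, {p : Fin m → ℝ |
          p j ≤ c / (S p1).card * (r + 1 : ℕ) ∧ numRej (S p1) a c p1 p = r + 1}.indicator
            (fun _ => 1 / ((r + 1 : ℕ) : ℝ)) (P ω) ∂μ :=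
        integral_mono hFDP (integrable_finsetSum _ fun j _ => integrable_finsetSum _
          fun r _ => hind j r) fun ω => FDP_rejSet_le ha hc I p1 (P ω)
    _ = ∑ j ∈ S p1 ∩ I, ∑ r ∈ range (S p1).card, 1 / ((r + 1 : ℕ) : ℝ) *
          μ.real {ω | P ω j ≤ c / (S p1).card * (r + 1 : ℕ) ∧
            numRej (S p1) a c p1 (P ω) = r + 1} := by
        rw [integral_finsetSum _ fun j _ => integrable_finsetSum _ fun r _ => hind j r]
        refine Finset.sum_congr rfl fun j _ => ?_
        rw [integral_finsetSum _ fun r _ => hind j r]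
        refine Finset.sum_congr rfl fun r _ => ?_
        exact (integral_indicator_const _ (hP (hset j r))).trans (mul_comm _ _)
    _ ≤ ∑ _j ∈ S p1 ∩ I, c / (S p1).card := by
        refine Finset.sum_le_sum fun j hj => ?_
        have hj' := hI j (Finset.mem_inter.1 hj).2
        exact hPRDS.sum_measureReal_le hP hPu hj' (hsup j hj') hNm
          (numRej_antitone _ a c p1) (by positivity) (hcard.trans hc1)
    _ ≤ (S p1).card * (c / (S p1).card) := by
        rw [Finset.sum_const, nsmul_eq_mul]
        gcongr
        exact Finset.inter_subset_left
    _ ≤ c := by rwa [mul_comm]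

/-- Lemma S2.1, item 2: if `P₁ ⟂ P₂`, the follow-up vector is PRDS on its
true nulls, and the selection rule is valid, Procedure 3.2 with parameters `(q₁, q)` satisfies
`E[|𝓡 ∩ I₁₀| / max(|𝓡|,1)] ≤ q - q₁`. -/
theorem lemma_S21_item2 {Ω : Type*} [MeasurableSpace Ω]
    (μ : Measure Ω) [IsProbabilityMeasure μ]
    (m : ℕ) (hm : 1 ≤ m)
    (P1 P2 : Ω → Fin m → ℝ) (hP1 : Measurable P1) (hP2 : Measurable P2)
    (hP1u : InUnit P1) (hP2u : InUnit P2)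
    (h1 h2 : Fin m → Bool)
    (hsup1 : Superuniform μ P1 h1) (hsup2 : Superuniform μ P2 h2)
    (hIndep : IndepFun P1 P2 μ)
    (hPRDS : PRDS μ P2 {j | h2 j = false})
    (S : (Fin m → ℝ) → Finset (Fin m)) (hS : MeasRule m S) (hval : ValidRule m S)
    (q1 q : ℝ) (hq1 : 0 < q1) (hq1q : q1 < q) (hq : q < 1) :
    ∫ ω, FDP (Iset h1 h2 true false)
        (rejSet m S q1 (fun _ => q - q1) (P1 ω) (P2 ω)) ∂μ ≤ q - q1 := by
  have hc : 0 ≤ q - q1 := by linarith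
  have hmeas := measurable_FDP_rejSet hS hq1.le hc (Iset h1 h2 true false)
  have : IsProbabilityMeasure (μ.map P1) := Measure.isProbabilityMeasure_map hP1.aemeasurable
  have : IsProbabilityMeasure (μ.map P2) := Measure.isProbabilityMeasure_map hP2.aemeasurable
  have hint : Integrable (fun x : (Fin m → ℝ) × (Fin m → ℝ) =>
      FDP (Iset h1 h2 true false) (rejSet m S q1 (fun _ => q - q1) x.1 x.2))
      ((μ.map P1).prod (μ.map P2)) :=
    Integrable.of_mem_Icc 0 1 hmeas.aemeasurable
      (ae_of_all _ fun x => ⟨FDP_nonneg _ _, FDP_le_one _ _⟩)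
  have hprod := (indepFun_iff_map_prod_eq_prod_map_map hP1.aemeasurable hP2.aemeasurable).1 hIndep
  rw [← integral_map (φ := fun ω => (P1 ω, P2 ω)) (hP1.prodMk hP2).aemeasurable
    hmeas.aestronglyMeasurable, hprod, integral_prod _ hint]
  calc _ ≤ ∫ _, q - q1 ∂(μ.map P1) := by
        refine integral_mono hint.integral_prod_left (integrable_const _) fun p1 => ?_
        refine (integral_map hP2.aemeasurable
          (hmeas.comp measurable_prodMk_left).aestronglyMeasurable).trans_le ?_
        exact integral_FDP_rejSet_le hP2 hP2u hsup2 hPRDS hS hq1.le hc (by linarith)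
          (fun j hj => (Finset.mem_filter.1 hj).2.2) p1
    _ = q - q1 := by simp

end Replicability
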